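/- Orthogonality of generalized complex Hermite polynomials: for β ≥ 0 and natural numbers j, n, l, m, one has (1/π) ∫_ℂ H_{j,n}^{(β)}(z,z̄) conj(H_{l,m}^{(β)}(z,z̄)) (z z̄)^β e^{-z z̄} dA(z) = (Γ(β + max(j,n) + 1)/min(j,n)!) δ_{j,l} δ_{n,m}, where dA is Lebesgue area measure on ℂ. -/

import Mathlib

open MeasureTheory

/-- Rising factorial (Pochhammer symbol) (a)_k for real a. -/
noncomputable def poch (a : ℝ) (k : ℕ) : ℝ := (ascPochhammer ℝ k).eval a

/-- Generalized Laguerre polynomial, at a complex argument. -/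
noncomputable def lag (α : ℝ) (m : ℕ) (x : ℂ) : ℂ :=
  ∑ k ∈ Finset.range (m + 1),
    ((poch (α + k + 1) (m - k) / Nat.factorial (m - k) : ℝ) : ℂ)
      * (-x) ^ k / (Nat.factorial k : ℂ)

/-- H_{n,m}^{(β)}(z,z̄) = (-1)^{min(n,m)} |z|^{|n-m|} e^{i(n-m) arg z}
L_{min(n,m)}^{(|n-m|+β)}(z z̄). -/
noncomputable def Hgen (β : ℝ) (n m : ℕ) (z : ℂ) : ℂ :=
  (-1 : ℂ) ^ (min n m) * (‖z‖ : ℂ) ^ (max n m - min n m)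
    * Complex.exp (Complex.I * (((n : ℝ) - m) * Complex.arg z : ℝ))
    * lag (((max n m - min n m : ℕ) : ℝ) + β) (min n m) (z * starRingEnd ℂ z)

/-- Coefficients of the Laguerre polynomial. -/
noncomputable def lagC (α : ℝ) (m i : ℕ) : ℝ :=
  poch (α + i + 1) (m - i) / Nat.factorial (m - i) * (-1) ^ i / Nat.factorial i

/-- Real Laguerre polynomial. -/
noncomputable def lagR (α : ℝ) (m : ℕ) (x : ℝ) : ℝ :=
  ∑ i ∈ Finset.range (m + 1), lagC α m i * x ^ i

theorem lag_ofReal (α : ℝ) (m : ℕ) (x : ℝ) : lag α m (x : ℂ) = (lagR α m x : ℂ) := by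
  unfold lag lagR lagC
  push_cast
  refine Finset.sum_congr rfl fun k _ => ?_
  rw [neg_pow]
  ring

theorem poch_mul_Gamma (s : ℝ) (hs : 0 < s) (k : ℕ) :
    poch s k * Real.Gamma s = Real.Gamma (s + k) := by
  induction k with
  | zero => simp [poch]
  | succ k ih =>
    unfold poch at *
    rw [ascPochhammer_succ_eval]
    push_cast
    rw [← add_assoc, Real.Gamma_add_one (by positivity), ← ih]
    ring

theorem moment_integrable (α : ℝ) (hα : 0 ≤ α) (k : ℕ) :
    IntegrableOn (fun x : ℝ => x ^ k * (x ^ α * Real.exp (-x))) (Set.Ioi 0) := by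
  have h := Real.GammaIntegral_convergent (s := α + k + 1) (by positivity)
  refine h.congr_fun (fun x hx => ?_) measurableSet_Ioi
  have hx : 0 < x := hx
  simp only [add_sub_cancel_right]
  rw [Real.rpow_add hx, Real.rpow_natCast]
  ring

theorem moment_eq (α : ℝ) (hα : 0 ≤ α) (k : ℕ) :
    ∫ x in Set.Ioi (0 : ℝ), x ^ k * (x ^ α * Real.exp (-x)) = Real.Gamma (α + k + 1) := by
  rw [Real.Gamma_eq_integral (by positivity)]
  refine setIntegral_congr_fun measurableSet_Ioi (fun x hx => ?_)
  have hx : 0 < x := hx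
  simp only [add_sub_cancel_right]
  rw [Real.rpow_add hx, Real.rpow_natCast]
  ring

theorem alt_sum (s : ℝ) (m k : ℕ) (hk : k ≤ m) :
    ∑ i ∈ Finset.range (m + 1), (-1 : ℝ) ^ i * m.choose i * poch (s + i) k
      = if k = m then (-1) ^ m * (m.factorial : ℝ) else 0 := by
  have h := fwdDiff_iter_eq_sum_shift (1 : ℝ) (ascPochhammer ℝ k).eval m s
  have h2 : ∑ i ∈ Finset.range (m + 1), (-1 : ℝ) ^ i * m.choose i * poch (s + i) k
      = (-1) ^ m * ((fwdDiff (1 : ℝ))^[m] (ascPochhammer ℝ k).eval s) := by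
    rw [h, Finset.mul_sum]
    refine Finset.sum_congr rfl fun i hi => ?_
    have hi : i ≤ m := by simpa [Nat.lt_succ_iff] using hi
    obtain ⟨t, rfl⟩ := Nat.exists_eq_add_of_le hi
    simp only [poch, zsmul_eq_mul, nsmul_eq_mul, mul_one, Nat.add_sub_cancel_left]
    push_cast
    have : (-1 : ℝ) ^ t * (-1) ^ t = 1 := by rw [← mul_pow]; simp
    rw [pow_add]
    linear_combination (-(-1 : ℝ) ^ i * (i + t).choose i * Polynomial.eval (s + i) (ascPochhammer ℝ k)) * this
  rw [h2]
  split_ifs with hkm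
  · subst hkm
    have h3 := Polynomial.fwdDiff_iter_degree_eq_factorial (ascPochhammer ℝ k)
    rw [ascPochhammer_natDegree, (monic_ascPochhammer ℝ k).leadingCoeff] at h3
    rw [h3]
    simp
  · rw [Polynomial.fwdDiff_iter_eq_zero_of_degree_lt]
    · simp
    · rw [ascPochhammer_natDegree]; omega

theorem lagC_moment (α : ℝ) (hα : 0 ≤ α) (m k : ℕ) (hk : k ≤ m) :
    ∑ i ∈ Finset.range (m + 1), lagC α m i * Real.Gamma (α + (k + i : ℕ) + 1)
      = if k = m then (-1) ^ m * Real.Gamma (α + m + 1) else 0 := by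
  have h : ∑ i ∈ Finset.range (m + 1), lagC α m i * Real.Gamma (α + (k + i : ℕ) + 1)
      = Real.Gamma (α + m + 1) / m.factorial *
        ∑ i ∈ Finset.range (m + 1), (-1 : ℝ) ^ i * m.choose i * poch (α + 1 + i) k := by
    rw [Finset.mul_sum]
    refine Finset.sum_congr rfl fun i hi => ?_
    have hi : i ≤ m := by simpa [Nat.lt_succ_iff] using hi
    have e1 := poch_mul_Gamma (α + i + 1) (by positivity) (m - i)
    have e2 := poch_mul_Gamma (α + i + 1) (by positivity) k
    rw [show α + (i : ℝ) + 1 + (m - i : ℕ) = α + m + 1 by push_cast [hi]; ring] at e1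
    rw [show α + ((k + i : ℕ) : ℝ) + 1 = α + i + 1 + k by push_cast; ring, ← e2, ← e1,
      Nat.cast_choose ℝ hi, show α + 1 + (i : ℝ) = α + i + 1 by ring]
    unfold lagC
    field_simp
  rw [h, alt_sum _ _ _ hk]
  split_ifs
  · field_simp
  · simp

theorem lag_prod_integral (α : ℝ) (hα : 0 ≤ α) (a b : ℕ) :
    ∫ x in Set.Ioi (0 : ℝ), lagR α a x * lagR α b x * (x ^ α * Real.exp (-x))
      = ∑ k ∈ Finset.range (a + 1), lagC α a k *
          ∑ i ∈ Finset.range (b + 1), lagC α b i * Real.Gamma (α + (k + i : ℕ) + 1) := by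
  have : ∀ x : ℝ, lagR α a x * lagR α b x * (x ^ α * Real.exp (-x))
      = ∑ k ∈ Finset.range (a + 1), ∑ i ∈ Finset.range (b + 1),
        lagC α a k * lagC α b i * (x ^ (k + i) * (x ^ α * Real.exp (-x))) := by
    intro x
    unfold lagR
    rw [Finset.sum_mul_sum, Finset.sum_mul]
    refine Finset.sum_congr rfl fun k _ => ?_
    rw [Finset.sum_mul]
    refine Finset.sum_congr rfl fun i _ => ?_
    ring
  simp_rw [this]
  rw [integral_finsetSum]
  · refine Finset.sum_congr rfl fun k _ => ?_
    rw [integral_finsetSum, Finset.mul_sum]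
    · refine Finset.sum_congr rfl fun i _ => ?_
      rw [integral_const_mul, moment_eq α hα, mul_assoc]
    · exact fun i _ => (moment_integrable α hα _).const_mul _
  · exact fun k _ => integrable_finsetSum _ fun i _ => (moment_integrable α hα _).const_mul _

theorem lag_orth_le (α : ℝ) (hα : 0 ≤ α) (a b : ℕ) (hab : a ≤ b) :
    ∫ x in Set.Ioi (0 : ℝ), lagR α a x * lagR α b x * (x ^ α * Real.exp (-x))
      = if a = b then Real.Gamma (α + a + 1) / a.factorial else 0 := by
  rw [lag_prod_integral α hα, Finset.sum_range_succ, Finset.sum_eq_zero, lagC_moment α hα _ _ hab]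
  · split_ifs with h
    · subst h
      have : (-1 : ℝ) ^ a * (-1) ^ a = 1 := by rw [← mul_pow]; simp
      simp only [lagC, Nat.sub_self, poch, ascPochhammer_zero, Polynomial.eval_one,
        Nat.factorial_zero, Nat.cast_one, div_one, one_mul, zero_add]
      linear_combination (Real.Gamma (α + a + 1) / a.factorial) * this
    · simp
  · intro k hk
    have hk : k < a := by simpa using hk
    rw [lagC_moment α hα _ _ (by omega), if_neg (by omega), mul_zero]

theorem lag_orth (α : ℝ) (hα : 0 ≤ α) (a b : ℕ) :
    ∫ x in Set.Ioi (0 : ℝ), lagR α a x * lagR α b x * (x ^ α * Real.exp (-x))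
      = if a = b then Real.Gamma (α + a + 1) / a.factorial else 0 := by
  rcases le_total a b with h | h
  · exact lag_orth_le α hα a b h
  · have := lag_orth_le α hα b a h
    simp_rw [mul_comm (lagR α b _)] at this
    rw [this]
    by_cases h : a = b
    · subst h; rfl
    · rw [if_neg h, if_neg (Ne.symm h)]

/-- Radial part. -/
noncomputable def Hrad (β : ℝ) (n m : ℕ) (r : ℝ) : ℝ :=
  (-1) ^ (min n m) * r ^ (max n m - min n m)
    * lagR (((max n m - min n m : ℕ) : ℝ) + β) (min n m) (r ^ 2)

theorem Hgen_polar (β : ℝ) (n m : ℕ) (r θ : ℝ) (hr : 0 < r) (hθ : θ ∈ Set.Ioo (-Real.pi) Real.pi) :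
    Hgen β n m (Complex.polarCoord.symm (r, θ))
      = (Hrad β n m r : ℂ) * Complex.exp (Complex.I * (((n : ℝ) - m) * θ : ℝ)) := by
  have h1 : ‖Complex.polarCoord.symm (r, θ)‖ = r := by
    rw [Complex.norm_polarCoord_symm, abs_of_pos hr]
  have h2 : Complex.arg (Complex.polarCoord.symm (r, θ)) = θ := by
    rw [Complex.polarCoord_symm_apply]
    simpa using Complex.arg_mul_cos_add_sin_mul_I hr (Set.Ioo_subset_Ioc_self hθ)
  unfold Hgen
  rw [Complex.mul_conj, Complex.normSq_eq_norm_sq, h1, h2, lag_ofReal]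
  unfold Hrad
  push_cast
  ring

theorem angular (d : ℤ) :
    ∫ θ in Set.Ioo (-Real.pi) Real.pi, Complex.exp (Complex.I * d * θ)
      = if d = 0 then 2 * (Real.pi : ℂ) else 0 := by
  rw [← integral_Ioc_eq_integral_Ioo, ← intervalIntegral.integral_of_le (by linarith [Real.pi_pos])]
  split_ifs with h
  · subst h
    simp
    ring
  · rw [integral_exp_mul_complex (by simp [h])]
    have : Complex.exp (Complex.I * d * Real.pi) = Complex.exp (Complex.I * d * (-Real.pi : ℝ)) := by
      rw [Complex.exp_eq_exp_iff_exists_int]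
      exact ⟨d, by push_cast; ring⟩
    rw [this]
    simp

theorem separated (β : ℝ) (j n l m : ℕ) :
    ∫ z : ℂ, Hgen β j n z * starRingEnd ℂ (Hgen β l m z)
        * ((((‖z‖ ^ 2 : ℝ) ^ β) * Real.exp (-‖z‖ ^ 2) : ℝ) : ℂ)
      = ((∫ r in Set.Ioi (0 : ℝ), r * (Hrad β j n r * Hrad β l m r
          * ((r ^ 2) ^ β * Real.exp (-r ^ 2))) : ℝ) : ℂ)
        * ∫ θ in Set.Ioo (-Real.pi) Real.pi,
          Complex.exp (Complex.I * (((j : ℤ) - n - (l - m) : ℤ) : ℂ) * θ) := by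
  rw [← Complex.integral_comp_polarCoord_symm, ← integral_complex_ofReal, ← setIntegral_prod_mul]
  refine setIntegral_congr_fun (measurableSet_Ioi.prod measurableSet_Ioo) ?_
  rintro ⟨r, θ⟩ ⟨hr, hθ⟩
  have hr : 0 < r := hr
  have h1 : ‖Complex.polarCoord.symm (r, θ)‖ = r := by
    rw [Complex.norm_polarCoord_symm, abs_of_pos hr]
  have hE : Complex.exp (Complex.I * (((j : ℤ) - n - (l - m) : ℤ) : ℂ) * θ)
      = Complex.exp (Complex.I * (((j : ℝ) - n) * θ : ℝ))
        * starRingEnd ℂ (Complex.exp (Complex.I * (((l : ℝ) - m) * θ : ℝ))) := by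
    rw [← Complex.exp_conj, ← Complex.exp_add]
    congr 1
    simp only [map_mul, Complex.conj_I, Complex.conj_ofReal]
    push_cast
    ring
  simp only [h1, Hgen_polar β _ _ r θ hr hθ, hE, map_mul, Complex.conj_ofReal, Complex.real_smul]
  push_cast
  ring

theorem radial (β : ℝ) (hβ : 0 ≤ β) (j n l m : ℕ) (h : (j : ℤ) - n - (l - m) = 0) :
    ∫ r in Set.Ioi (0 : ℝ), r * (Hrad β j n r * Hrad β l m r
          * ((r ^ 2) ^ β * Real.exp (-r ^ 2)))
      = 1 / 2 * if min j n = min l m then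
          Real.Gamma (β + (max j n : ℕ) + 1) / (Nat.factorial (min j n)) else 0 := by
  have hd : max l m - min l m = max j n - min j n := by omega
  set a := min j n with ha
  set b := min l m with hb
  set d := max j n - a with hdd
  have hmax : ((max j n : ℕ) : ℝ) = d + a := by
    have : max j n = d + a := by omega
    rw [this]; push_cast; ring
  have key := lag_orth (d + β) (by positivity) a b
  rw [← integral_comp_rpow_Ioi_of_pos (p := 2) two_pos] at key
  rw [hmax, show β + ((d : ℝ) + a) + 1 = d + β + a + 1 by ring]
  have hs : (-1 : ℝ) ^ (a + b) * (if a = b then Real.Gamma (d + β + a + 1) / a.factorial else 0)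
      = (if a = b then Real.Gamma (d + β + a + 1) / a.factorial else 0) := by
    split_ifs with h
    · rw [← h, Even.neg_one_pow ⟨a, rfl⟩, one_mul]
    · simp
  rw [← hs, ← key, ← integral_const_mul, ← integral_const_mul]
  refine setIntegral_congr_fun measurableSet_Ioi (fun r hr => ?_)
  have hr : 0 < r := hr
  simp only [Hrad, ← ha, ← hb, hd, ← hdd, smul_eq_mul]
  rw [show (2 : ℝ) - 1 = 1 by norm_num, Real.rpow_one, Real.rpow_two,
    Real.rpow_add (by positivity), Real.rpow_natCast]
  ring

/-- Orthogonality of the generalized complex Hermite polynomials with respect to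
the weight (z z̄)^β e^{-z z̄} on ℂ. -/
theorem Hgen_orthogonality (β : ℝ) (hβ : 0 ≤ β) (j n l m : ℕ) :
    (1 / (Real.pi : ℂ)) *
      ∫ z : ℂ, Hgen β j n z * starRingEnd ℂ (Hgen β l m z)
        * ((((‖z‖ ^ 2 : ℝ) ^ β) * Real.exp (-‖z‖ ^ 2) : ℝ) : ℂ)
      = ((Real.Gamma (β + (max j n : ℕ) + 1) / (Nat.factorial (min j n)) : ℝ) : ℂ)
          * (if j = l then 1 else 0) * (if n = m then 1 else 0) := by
  rw [separated, angular]
  by_cases h : (j : ℤ) - n - (l - m) = 0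
  · rw [if_pos h, radial β hβ j n l m h]
    have hpi : (Real.pi : ℂ) ≠ 0 := by exact_mod_cast Real.pi_ne_zero
    by_cases hjl : j = l
    · have hnm : n = m := by omega
      rw [if_pos (by rw [hjl, hnm]), if_pos hjl, if_pos hnm]
      push_cast
      field_simp
    · rw [if_neg (by omega), if_neg hjl]
      simp
  · rw [if_neg h]
    by_cases hjl : j = l
    · rw [if_neg (show ¬ n = m by omega)]
      simp
    · rw [if_neg hjl]
      simp
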